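/- arXiv:2409.00717 — 5 statements merged into one kernel-verified Lean document; each statement's English description precedes it below -/
import Mathlib

section
/- (Pessimistic value gap is bounded by the accumulated bonus.) In the finite-horizon tabular setting, let π be a Markov policy, let b_h : S × A → ℝ be bonus functions, and suppose Q̲_h : S × A → ℝ and V̲_h : S → ℝ (for h ∈ {1,…,H+1}) satisfy: V̲_{H+1}(s) = 0; 0 ≤ (r_h(s,a) + ∑_{s'} P_h(s,a)(s')·V̲_{h+1}(s')) − Q̲_h(s,a) ≤ b_h(s,a) for all h, s, a; and V̲_h(s) = ∑_a π_h(s)(a)·Q̲_h(s,a). Let V^{π,b} denote the value functions of π computed with the rewards b_h in place of r_h. Then V^π_h(s) − V̲_h(s) ≤ V^{π,b}_h(s) for every h ∈ {1,…,H+1} and every s ∈ S. -/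
/-- Pessimistic value gap is bounded by the accumulated bonus.
`Vpi, Qpi` : value functions of the policy `π` under rewards `r`;
`Vb, Qb` : value functions of `π` under the bonus rewards `b`;
`Vlo, Qlo` : pessimistic estimates whose Bellman error lies in `[0, b]`. -/
theorem pessimistic_value_gap_le_bonus_value
    {S A : Type*} [Fintype S] [Fintype A] [Nonempty S] [Nonempty A]
    (H : ℕ)
    (P : ℕ → S → A → S → ℝ) (r : ℕ → S → A → ℝ) (b : ℕ → S → A → ℝ)
    (hP0 : ∀ h s a s', 1 ≤ h → h ≤ H → 0 ≤ P h s a s')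
    (hP1 : ∀ h s a, 1 ≤ h → h ≤ H → ∑ s', P h s a s' = 1)
    (π : ℕ → S → A → ℝ)
    (hπ0 : ∀ h s a, 1 ≤ h → h ≤ H → 0 ≤ π h s a)
    (hπ1 : ∀ h s, 1 ≤ h → h ≤ H → ∑ a, π h s a = 1)
    (Vpi : ℕ → S → ℝ) (Qpi : ℕ → S → A → ℝ)
    (hVpiEnd : ∀ s, Vpi (H + 1) s = 0)
    (hQpi : ∀ h s a, 1 ≤ h → h ≤ H →
      Qpi h s a = r h s a + ∑ s', P h s a s' * Vpi (h + 1) s')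
    (hVpi : ∀ h s, 1 ≤ h → h ≤ H → Vpi h s = ∑ a, π h s a * Qpi h s a)
    (Vb : ℕ → S → ℝ) (Qb : ℕ → S → A → ℝ)
    (hVbEnd : ∀ s, Vb (H + 1) s = 0)
    (hQb : ∀ h s a, 1 ≤ h → h ≤ H →
      Qb h s a = b h s a + ∑ s', P h s a s' * Vb (h + 1) s')
    (hVb : ∀ h s, 1 ≤ h → h ≤ H → Vb h s = ∑ a, π h s a * Qb h s a)
    (Vlo : ℕ → S → ℝ) (Qlo : ℕ → S → A → ℝ)
    (hVloEnd : ∀ s, Vlo (H + 1) s = 0)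
    (hQlo0 : ∀ h s a, 1 ≤ h → h ≤ H →
      0 ≤ (r h s a + ∑ s', P h s a s' * Vlo (h + 1) s') - Qlo h s a)
    (hQlob : ∀ h s a, 1 ≤ h → h ≤ H →
      (r h s a + ∑ s', P h s a s' * Vlo (h + 1) s') - Qlo h s a ≤ b h s a)
    (hVlo : ∀ h s, 1 ≤ h → h ≤ H → Vlo h s = ∑ a, π h s a * Qlo h s a) :
    ∀ h s, 1 ≤ h → h ≤ H + 1 → Vpi h s - Vlo h s ≤ Vb h s := by
  intro h s h1 hH
  induction hH using Nat.decreasingInduction generalizing s with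
  | self => simp [hVpiEnd, hVloEnd, hVbEnd]
  | of_succ k hk ih =>
    have hk' : k ≤ H := by omega
    rw [hVpi k s h1 hk', hVlo k s h1 hk', hVb k s h1 hk', ← Finset.sum_sub_distrib]
    apply Finset.sum_le_sum
    intro a _
    rw [← mul_sub]
    apply mul_le_mul_of_nonneg_left _ (hπ0 k s a h1 hk')
    have e : ∑ s', P k s a s' * Vpi (k + 1) s' - ∑ s', P k s a s' * Vlo (k + 1) s'
        ≤ ∑ s', P k s a s' * Vb (k + 1) s' := by
      rw [← Finset.sum_sub_distrib]
      apply Finset.sum_le_sum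
      intro s' _
      rw [← mul_sub]
      exact mul_le_mul_of_nonneg_left (ih s' (by omega)) (hP0 k s a s' h1 hk')
    have := hQlob k s a h1 hk'
    rw [hQpi k s a h1 hk', hQb k s a h1 hk']
    linarith
end

section
/- (Optimistic best-response gap is bounded by the worst-case accumulated bonus.) In the finite-horizon tabular setting with factored actions A = A_i × A_{-i} and opponents' policy π_{-i}, let b_h : S × A → ℝ be nonnegative bonus functions, and suppose Q̄_h : S × A → ℝ and V̄_h : S → ℝ (for h ∈ {1,…,H+1}) satisfy: V̄_{H+1}(s) = 0; 0 ≤ Q̄_h(s,a) − (r_h(s,a) + ∑_{s'} P_h(s,a)(s')·V̄_{h+1}(s')) ≤ b_h(s,a) for all h, s, a; and V̄_h(s) = max_{a_i ∈ A_i} ∑_{a_{-i}} π_{-i,h}(s)(a_{-i})·Q̄_h(s,(a_i,a_{-i})). Then for every s ∈ S, V̄_1(s) − V†_1(s) ≤ max over Markov policies π_i for player i of V^{(π_i,π_{-i}),b}_1(s), where (π_i,π_{-i}) is the joint policy choosing a_i ∼ π_{i,h}(s) and a_{-i} ∼ π_{-i,h}(s) independently, and V^{(π_i,π_{-i}),b}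 is its value function computed with the rewards b_h in place of r_h. -/
/-- Value function of the joint policy `(πi, πmi)` under rewards `b`, defined by
backward recursion: `V (H+1) s = 0` (indeed `V h s = 0` for `h > H`), and for `h ≤ H`,
`V h s = ∑_{(ai,b)} πi h s ai * πmi h s b * (reward + ∑_{s'} P h s a s' * V (h+1) s')`. -/
noncomputable def jointValue {S Ai Ani : Type*} [Fintype S] [Fintype Ai] [Fintype Ani]
    (H : ℕ) (P : ℕ → S → Ai × Ani → S → ℝ) (b : ℕ → S → Ai × Ani → ℝ)
    (πi : ℕ → S → Ai → ℝ) (πmi : ℕ → S → Ani → ℝ) (h : ℕ) (s : S) : ℝ :=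
  if hh : h ≤ H then
    ∑ a : Ai × Ani, πi h s a.1 * πmi h s a.2 *
      (b h s a + ∑ s', P h s a s' * jointValue H P b πi πmi (h + 1) s')
  else 0
termination_by H + 1 - h
decreasing_by omega

theorem jointValue_bdd_aux
    {S Ai Ani : Type*} [Fintype S] [Fintype Ai] [Fintype Ani]
    (H : ℕ) (P : ℕ → S → Ai × Ani → S → ℝ)
    (b : ℕ → S → Ai × Ani → ℝ)
    (hP0 : ∀ h s a s', 1 ≤ h → h ≤ H → 0 ≤ P h s a s')
    (hP1 : ∀ h s a, 1 ≤ h → h ≤ H → ∑ s', P h s a s' = 1)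
    (hb0 : ∀ h s a, 1 ≤ h → h ≤ H → 0 ≤ b h s a)
    (πmi : ℕ → S → Ani → ℝ)
    (hπ0 : ∀ h s c, 1 ≤ h → h ≤ H → 0 ≤ πmi h s c)
    (hπ1 : ∀ h s, 1 ≤ h → h ≤ H → ∑ c, πmi h s c = 1) (n : ℕ) :
    ∀ h, 1 ≤ h → h + n = H + 1 → ∃ C : ℝ, ∀ πi : ℕ → S → Ai → ℝ,
        (∀ h s' ai, 1 ≤ h → h ≤ H → 0 ≤ πi h s' ai) →
        (∀ h s', 1 ≤ h → h ≤ H → ∑ ai, πi h s' ai = 1) →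
        ∀ s, jointValue H P b πi πmi h s ≤ C := by
  induction n with
  | zero =>
    intro h h1 hn
    refine ⟨0, fun πi _ _ s => ?_⟩
    rw [jointValue, dif_neg (by omega)]
  | succ n ih =>
    intro h h1 hn
    have hH : h ≤ H := by omega
    obtain ⟨C, hC⟩ := ih (h + 1) (by omega) (by omega)
    refine ⟨(∑ p : S × (Ai × Ani), b h p.1 p.2) + C, fun πi hi0 hi1 s => ?_⟩
    rw [jointValue, dif_pos hH]
    have key : ∀ a : Ai × Ani, b h s a + ∑ s', P h s a s' * jointValue H P b πi πmi (h + 1) s'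
        ≤ (∑ p : S × (Ai × Ani), b h p.1 p.2) + C := by
      intro a
      have e1 : b h s a ≤ ∑ p : S × (Ai × Ani), b h p.1 p.2 :=
        Finset.single_le_sum (f := fun p : S × (Ai × Ani) => b h p.1 p.2)
          (fun p _ => hb0 h p.1 p.2 h1 hH) (Finset.mem_univ (s, a))
      have e2 : ∑ s', P h s a s' * jointValue H P b πi πmi (h + 1) s' ≤ ∑ s', P h s a s' * C :=
        Finset.sum_le_sum fun s' _ =>
          mul_le_mul_of_nonneg_left (hC πi hi0 hi1 s') (hP0 h s a s' h1 hH)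
      rw [← Finset.sum_mul, hP1 h s a h1 hH, one_mul] at e2
      linarith
    refine (Finset.sum_le_sum fun a _ => mul_le_mul_of_nonneg_left (key a)
      (mul_nonneg (hi0 h s a.1 h1 hH) (hπ0 h s a.2 h1 hH))).trans ?_
    rw [← Finset.sum_mul, Fintype.sum_prod_type]
    simp only [← Finset.mul_sum, hπ1 h s h1 hH, mul_one, hi1 h s h1 hH, one_mul, le_refl]

/-- Optimistic best-response gap is bounded by the worst-case accumulated bonus:
`V̄₁(s) − V†₁(s) ≤ sup_{πi Markov policy} V^{(πi,π₋ᵢ),b}₁(s)`. -/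
theorem optimistic_gap_le_max_bonus_value
    {S Ai Ani : Type*} [Fintype S] [Fintype Ai] [Fintype Ani]
    [Nonempty S] [Nonempty Ai] [Nonempty Ani]
    (H : ℕ)
    (P : ℕ → S → Ai × Ani → S → ℝ) (r : ℕ → S → Ai × Ani → ℝ)
    (b : ℕ → S → Ai × Ani → ℝ)
    (hP0 : ∀ h s a s', 1 ≤ h → h ≤ H → 0 ≤ P h s a s')
    (hP1 : ∀ h s a, 1 ≤ h → h ≤ H → ∑ s', P h s a s' = 1)
    (hb0 : ∀ h s a, 1 ≤ h → h ≤ H → 0 ≤ b h s a)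
    (πmi : ℕ → S → Ani → ℝ)
    (hπ0 : ∀ h s c, 1 ≤ h → h ≤ H → 0 ≤ πmi h s c)
    (hπ1 : ∀ h s, 1 ≤ h → h ≤ H → ∑ c, πmi h s c = 1)
    (Vdag : ℕ → S → ℝ) (Qdag : ℕ → S → Ai × Ani → ℝ)
    (hVdagEnd : ∀ s, Vdag (H + 1) s = 0)
    (hQdag : ∀ h s a, 1 ≤ h → h ≤ H →
      Qdag h s a = r h s a + ∑ s', P h s a s' * Vdag (h + 1) s')
    (hVdag : ∀ h s, 1 ≤ h → h ≤ H →
      Vdag h s = ⨆ ai : Ai, ∑ c, πmi h s c * Qdag h s (ai, c))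
    (Vup : ℕ → S → ℝ) (Qup : ℕ → S → Ai × Ani → ℝ)
    (hVupEnd : ∀ s, Vup (H + 1) s = 0)
    (hQup0 : ∀ h s a, 1 ≤ h → h ≤ H →
      0 ≤ Qup h s a - (r h s a + ∑ s', P h s a s' * Vup (h + 1) s'))
    (hQupb : ∀ h s a, 1 ≤ h → h ≤ H →
      Qup h s a - (r h s a + ∑ s', P h s a s' * Vup (h + 1) s') ≤ b h s a)
    (hVup : ∀ h s, 1 ≤ h → h ≤ H →
      Vup h s = ⨆ ai : Ai, ∑ c, πmi h s c * Qup h s (ai, c)) :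
    ∀ s, Vup 1 s - Vdag 1 s ≤
      sSup {x : ℝ | ∃ πi : ℕ → S → Ai → ℝ,
        (∀ h s' ai, 1 ≤ h → h ≤ H → 0 ≤ πi h s' ai) ∧
        (∀ h s', 1 ≤ h → h ≤ H → ∑ ai, πi h s' ai = 1) ∧
        x = jointValue H P b πi πmi 1 s} := by
  classical
  intro s
  have hg : ∀ h s, ∃ g : Ai, ∀ ai, ∑ c, πmi h s c * Qup h s (ai, c)
      ≤ ∑ c, πmi h s c * Qup h s (g, c) := fun h s => Finite.exists_max _
  choose g hg using hg
  let πi : ℕ → S → Ai → ℝ := fun h s a => if a = g h s then 1 else 0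
  have main : ∀ n h, 1 ≤ h → h + n = H + 1 → ∀ s,
      Vup h s - Vdag h s ≤ jointValue H P b πi πmi h s := by
    intro n
    induction n with
    | zero =>
      intro h h1 hn s
      obtain rfl : h = H + 1 := by omega
      rw [jointValue, dif_neg (by omega), hVupEnd, hVdagEnd, sub_zero]
    | succ n ih =>
      intro h h1 hn s
      have hH : h ≤ H := by omega
      have IH := ih (h + 1) (by omega) (by omega)
      have e1 : Vup h s ≤ ∑ c, πmi h s c * Qup h s (g h s, c) := by
        rw [hVup h s h1 hH]
        exact ciSup_le (hg h s)
      have e2 : ∑ c, πmi h s c * Qdag h s (g h s, c) ≤ Vdag h s := by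
        rw [hVdag h s h1 hH]
        exact le_ciSup (f := fun ai => ∑ c, πmi h s c * Qdag h s (ai, c))
          (Set.finite_range _).bddAbove (g h s)
      have e3 : jointValue H P b πi πmi h s = ∑ c, πmi h s c * (b h s (g h s, c) +
          ∑ s', P h s (g h s, c) s' * jointValue H P b πi πmi (h + 1) s') := by
        rw [jointValue, dif_pos hH, Fintype.sum_prod_type, Finset.sum_eq_single (g h s)]
        · simp [πi]
        · intro a _ ha
          simp [πi, ha]
        · simp
      have e4 : ∑ c, πmi h s c * Qup h s (g h s, c) - ∑ c, πmi h s c * Qdag h s (g h s, c)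
          ≤ jointValue H P b πi πmi h s := by
        rw [e3, ← Finset.sum_sub_distrib]
        refine Finset.sum_le_sum fun c _ => ?_
        rw [← mul_sub]
        refine mul_le_mul_of_nonneg_left ?_ (hπ0 h s c h1 hH)
        have q1 := hQupb h s (g h s, c) h1 hH
        have q2 := hQdag h s (g h s, c) h1 hH
        have q3 : ∑ s', P h s (g h s, c) s' * (Vup (h + 1) s' - Vdag (h + 1) s') ≤
            ∑ s', P h s (g h s, c) s' * jointValue H P b πi πmi (h + 1) s' :=
          Finset.sum_le_sum fun s' _ =>
            mul_le_mul_of_nonneg_left (IH s') (hP0 h s _ s' h1 hH)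
        simp only [mul_sub, Finset.sum_sub_distrib] at q3
        linarith
      linarith
  refine (main H 1 le_rfl (by omega) s).trans (le_csSup ?_ ⟨πi, ?_, ?_, rfl⟩)
  · obtain ⟨C, hC⟩ := jointValue_bdd_aux H P b hP0 hP1 hb0 πmi hπ0 hπ1 H 1 le_rfl (by omega)
    refine ⟨C, ?_⟩
    rintro x ⟨p, hp0, hp1, rfl⟩
    exact hC p hp0 hp1 s
  · intro h s' ai _ _
    simp only [πi]
    split_ifs <;> norm_num
  · intro h s' _ _
    simp [πi]
end

section
/- (Unilateral-coverage guarantee, abstract form of Theorem 5.) In the abstract m-player setting, suppose: (i) V̲_i, V̄_i : Π → ℝ satisfy V̲_i(π) ≤ V_i(π) and V̄_i(π) ≥ V_i†(π_{-i}) for all π ∈ Π and all i; (ii) there is a function U : Π → ℝ such that V_i(π) − V̲_i(π) ≤ U(π) for all π and all i, and V̄_i(π*_{ }) − V_i†(π*_{-i}) ≤ max_{π_i ∈ Π_i} U(π_i, π*_{-i}) for all i, where π* ∈ Π is a Nash equilibrium (Gap(π*) = 0); (iii) π^out minimizes π ↦ ∑_{i=1}^m (V̄_i(π) − V̲_i(π))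 over Π. Then Gap(π^out) ≤ 2·∑_{i=1}^m max_{π_i ∈ Π_i} U(π_i, π*_{-i}). -/
/-- Unilateral-coverage guarantee (abstract form of Theorem 5): with valid
pessimistic/optimistic estimates `Vlo, Vup`, an uncertainty function `U` bounding the
pessimism gap everywhere and the optimism overshoot at a Nash equilibrium `πstar`
(via unilateral deviations), and `πout` minimizing the surrogate
`π ↦ ∑ᵢ (Vup i π − Vlo i π)`, the Nash gap of `πout` is at most
`2 ∑ᵢ sup_{πᵢ} U(πᵢ, πstar₋ᵢ)`. -/
theorem unilateral_coverage_guarantee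
    {m : ℕ} (Pi : Fin m → Type*) [∀ i, Fintype (Pi i)] [∀ i, Nonempty (Pi i)]
    (V : ∀ _ : Fin m, (∀ j, Pi j) → ℝ)
    (Vlo Vup : ∀ _ : Fin m, (∀ j, Pi j) → ℝ)
    (hlo : ∀ i π, Vlo i π ≤ V i π)
    (hup : ∀ i π, (⨆ πi' : Pi i, V i (Function.update π i πi')) ≤ Vup i π)
    (U : (∀ j, Pi j) → ℝ)
    (hUlo : ∀ i π, V i π - Vlo i π ≤ U π)
    (πstar : ∀ j, Pi j)
    (hNash : ∑ i, ((⨆ πi' : Pi i, V i (Function.update πstar i πi')) - V i πstar) = 0)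
    (hUup : ∀ i, Vup i πstar - (⨆ πi' : Pi i, V i (Function.update πstar i πi'))
      ≤ ⨆ πi : Pi i, U (Function.update πstar i πi))
    (πout : ∀ j, Pi j)
    (hmin : ∀ π : ∀ j, Pi j,
      ∑ i, (Vup i πout - Vlo i πout) ≤ ∑ i, (Vup i π - Vlo i π)) :
    ∑ i, ((⨆ πi' : Pi i, V i (Function.update πout i πi')) - V i πout)
      ≤ 2 * ∑ i, ⨆ πi : Pi i, U (Function.update πstar i πi) := by
  have h1 : ∑ i, ((⨆ πi' : Pi i, V i (Function.update πout i πi')) - V i πout)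
      ≤ ∑ i, (Vup i πout - Vlo i πout) :=
    Finset.sum_le_sum fun i _ => sub_le_sub (hup i πout) (hlo i πout)
  have h2 : ∑ i, (Vup i πstar - Vlo i πstar) ≤
      ∑ i, (2 * (⨆ πi : Pi i, U (Function.update πstar i πi)) +
        ((⨆ πi' : Pi i, V i (Function.update πstar i πi')) - V i πstar)) := by
    refine Finset.sum_le_sum fun i _ => ?_
    have hU : U πstar ≤ ⨆ πi : Pi i, U (Function.update πstar i πi) := by
      have h := le_ciSup (f := fun πi : Pi i => U (Function.update πstar i πi))
        (Set.finite_range _).bddAbove (πstar i)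
      simpa only [Function.update_eq_self] using h
    have ha := hUlo i πstar
    have hb := hUup i
    linarith
  rw [Finset.sum_add_distrib, hNash, add_zero, ← Finset.mul_sum] at h2
  exact h1.trans ((hmin πstar).trans h2)
end

section
/- For the two matrix games M1 and M2, every mixed strategy profile (μ, ν) satisfies Gap_1(μ, ν) + Gap_2(μ, ν) = 1. -/
/-- Payoff of game `M1` (row player `a`, indexed by `Fin 2` with `0 = a1`, minimizes;
column player `b`, with `0 = b1`, maximizes): `R1(a1,b1)=1/2, R1(a2,b1)=1,
R1(a1,b2)=0, R1(a2,b2)=1/2`. -/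
noncomputable def R1 : Fin 2 → Fin 2 → ℝ := fun a b =>
  if a = 0 then (if b = 0 then 1/2 else 0) else (if b = 0 then 1 else 1/2)

/-- Payoff of game `M2`: `R2(a1,b1)=1/2, R2(a2,b1)=0, R2(a1,b2)=1, R2(a2,b2)=1/2`. -/
noncomputable def R2 : Fin 2 → Fin 2 → ℝ := fun a b =>
  if a = 0 then (if b = 0 then 1/2 else 1) else (if b = 0 then 0 else 1/2)

/-- Point mass at `x` on `Fin 2`. -/
noncomputable def delta (x : Fin 2) : Fin 2 → ℝ := fun y => if y = x then 1 else 0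

/-- Expected payoff `V(μ,ν) = ∑_{a,b} μ(a)·ν(b)·R(a,b)` of a mixed profile. -/
noncomputable def gameVal (R : Fin 2 → Fin 2 → ℝ) (μ ν : Fin 2 → ℝ) : ℝ :=
  ∑ a, ∑ b, μ a * ν b * R a b

/-- Nash gap
`Gap(μ,ν) = (V(μ,ν) − min_a V(δ_a, ν)) + (max_b V(μ, δ_b) − V(μ,ν))`. -/
noncomputable def gap (R : Fin 2 → Fin 2 → ℝ) (μ ν : Fin 2 → ℝ) : ℝ :=
  (gameVal R μ ν - ⨅ a : Fin 2, gameVal R (delta a) ν) +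
    ((⨆ b : Fin 2, gameVal R μ (delta b)) - gameVal R μ ν)

/-- For the games `M1` and `M2`, every mixed strategy profile `(μ, ν)` satisfies
`Gap₁(μ,ν) + Gap₂(μ,ν) = 1`. -/
theorem gap_M1_add_gap_M2_eq_one (μ ν : Fin 2 → ℝ)
    (hμ0 : ∀ a, 0 ≤ μ a) (hμ1 : ∑ a, μ a = 1)
    (hν0 : ∀ b, 0 ≤ ν b) (hν1 : ∑ b, ν b = 1) :
    gap R1 μ ν + gap R2 μ ν = 1 := by
  have hmin : ∀ f : Fin 2 → ℝ, (⨅ a, f a) = min (f 0) (f 1) := by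
    intro f
    apply le_antisymm
    · exact le_min (ciInf_le (Set.finite_range f).bddBelow 0)
        (ciInf_le (Set.finite_range f).bddBelow 1)
    · apply le_ciInf
      intro a
      fin_cases a
      · exact min_le_left _ _
      · exact min_le_right _ _
  have hmax : ∀ f : Fin 2 → ℝ, (⨆ a, f a) = max (f 0) (f 1) := by
    intro f
    apply le_antisymm
    · apply ciSup_le
      intro a
      fin_cases a
      · exact le_max_left _ _
      · exact le_max_right _ _
    · exact max_le (le_ciSup (Set.finite_range f).bddAbove 0)
        (le_ciSup (Set.finite_range f).bddAbove 1)
  have m0 := hμ0 0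
  have m1 := hμ0 1
  have n0 := hν0 0
  have n1 := hν0 1
  rw [Fin.sum_univ_two] at hμ1 hν1
  unfold gap
  rw [hmin, hmin, hmax, hmax]
  have e1 : min (gameVal R1 (delta 0) ν) (gameVal R1 (delta 1) ν) = ν 0 / 2 := by
    simp only [gameVal, Fin.sum_univ_two, R1, delta]
    norm_num
    rw [min_eq_left] <;> linarith
  have e2 : min (gameVal R2 (delta 0) ν) (gameVal R2 (delta 1) ν) = ν 1 / 2 := by
    simp only [gameVal, Fin.sum_univ_two, R2, delta]
    norm_num
    rw [min_eq_right] <;> linarith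
  have e3 : max (gameVal R1 μ (delta 0)) (gameVal R1 μ (delta 1)) = μ 0 / 2 + μ 1 := by
    simp only [gameVal, Fin.sum_univ_two, R1, delta]
    norm_num
    rw [max_eq_left] <;> linarith
  have e4 : max (gameVal R2 μ (delta 0)) (gameVal R2 μ (delta 1)) = μ 0 + μ 1 / 2 := by
    simp only [gameVal, Fin.sum_univ_two, R2, delta]
    norm_num
    rw [max_eq_right] <;> linarith
  rw [e1, e2, e3, e4]
  linarith
end

section
/- (Single policy coverage is insufficient: core of Theorem 3.) For the two matrix games M1 and M2, every mixed strategy profile (μ, ν) satisfies max(Gap_1(μ, ν), Gap_2(μ, ν)) ≥ 1/2; in particular, no strategy profile is an ε-Nash equilibrium of both M1 and M2 for any ε < 1/2. -/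
/-- Single policy coverage is insufficient (core of Theorem 3): every mixed strategy
profile `(μ, ν)` satisfies `max(Gap₁(μ,ν), Gap₂(μ,ν)) ≥ 1/2`; in particular, no
profile is an `ε`-Nash equilibrium of both `M1` and `M2` for any `ε < 1/2`. -/
theorem no_profile_is_good_in_both_games (μ ν : Fin 2 → ℝ)
    (hμ0 : ∀ a, 0 ≤ μ a) (hμ1 : ∑ a, μ a = 1)
    (hν0 : ∀ b, 0 ≤ ν b) (hν1 : ∑ b, ν b = 1) :
    1/2 ≤ max (gap R1 μ ν) (gap R2 μ ν) ∧
    ∀ ε : ℝ, ε < 1/2 → ¬(gap R1 μ ν ≤ ε ∧ gap R2 μ ν ≤ ε) := by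
  have key : ∀ (R : Fin 2 → Fin 2 → ℝ) (a b : Fin 2),
      gameVal R μ (delta b) - gameVal R (delta a) ν ≤ gap R μ ν := by
    intro R a b
    have h1 : (⨅ a : Fin 2, gameVal R (delta a) ν) ≤ gameVal R (delta a) ν :=
      ciInf_le (Set.finite_range _).bddBelow a
    have h2 : gameVal R μ (delta b) ≤ ⨆ b : Fin 2, gameVal R μ (delta b) :=
      le_ciSup (f := fun b : Fin 2 => gameVal R μ (delta b)) (Set.finite_range _).bddAbove b
    unfold gap
    linarith
  have g1 := key R1 0 0
  have g2 := key R2 1 1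
  simp [gameVal, delta, R1, Fin.sum_univ_two] at g1
  simp [gameVal, delta, R2, Fin.sum_univ_two] at g2
  rw [Fin.sum_univ_two] at hμ1 hν1
  have hsum : 1 ≤ gap R1 μ ν + gap R2 μ ν := by linarith
  refine ⟨?_, ?_⟩
  · have := le_max_left (gap R1 μ ν) (gap R2 μ ν)
    have := le_max_right (gap R1 μ ν) (gap R2 μ ν)
    linarith
  · rintro ε hε ⟨h1, h2⟩
    linarith
end
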